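/- There is a constant C > 0 such that for every integer n ≥ 3 and every vertex u ∈ V, the expected number of undirected four-cycles rooted at u in the UTSW random graph G(c) — i.e., the expected number of triples (a,b,e) of vertices, pairwise distinct and distinct from u, such that {u,a}, {a,b}, {b,e}, {e,u} are all edges of G(c), where each cycle is counted once, identifying (a,b,e) with its reversal (e,b,a) — is at most 4 + C / ln n. -/

import Mathlib

open scoped Classical
open Finset

/-- Vertex set of the `n × n` torus. -/
abbrev Vx (n : ℕ) := Fin n × Fin n

/-- Toroidal distance on the `n × n` torus. -/
def tdist (n : ℕ) (u v : Vx n) : ℕ :=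
  min ((u.1 : ℤ) - (v.1 : ℤ)).natAbs (n - ((u.1 : ℤ) - (v.1 : ℤ)).natAbs) +
  min ((u.2 : ℤ) - (v.2 : ℤ)).natAbs (n - ((u.2 : ℤ) - (v.2 : ℤ)).natAbs)

/-- The normalizing factor at vertex `u`. -/
noncomputable def Zfac (n : ℕ) (u : Vx n) : ℝ :=
  (∑ w ∈ univ.filter (fun w => w ≠ u), ((tdist n u w : ℝ) ^ 2)⁻¹)⁻¹

/-- The probability mass of the outcome `c : V → V` (the vector of long-range choices)
under the UTSW product measure: each vertex `u` independently chooses `c u = v ≠ u`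
with probability `Z · d(u,v)⁻²`. -/
noncomputable def mass (n : ℕ) (c : Vx n → Vx n) : ℝ :=
  ∏ u : Vx n, if c u = u then 0 else Zfac n u * ((tdist n u (c u) : ℝ) ^ 2)⁻¹

/-- Probability of an event under the UTSW product measure. -/
noncomputable def Pr (n : ℕ) (E : Set (Vx n → Vx n)) : ℝ :=
  ∑ c : Vx n → Vx n, if c ∈ E then mass n c else 0

/-- `{x, y}` is an edge of the UTSW random graph `G(c)`. -/
def isEdge (n : ℕ) (c : Vx n → Vx n) (x y : Vx n) : Prop :=
  x ≠ y ∧ (tdist n x y = 1 ∨ c x = y ∨ c y = x)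

/-- `{x, y}` is an edge of `G(c)` of the given kind: local (`w = false`, distance one)
or long-range (`w = true`, distance not one). -/
def edgeKind (n : ℕ) (c : Vx n → Vx n) (x y : Vx n) (w : Bool) : Prop :=
  isEdge n c x y ∧ (tdist n x y = 1 ↔ w = false)

/-- There is a four-cycle rooted at `u` in `G(c)` whose edge sequence has the local/long-range
pattern `(p₁, p₂, p₃, p₄)` (`false` = local edge, `true` = long-range edge). -/
def cyclePat (n : ℕ) (c : Vx n → Vx n) (u : Vx n) (p₁ p₂ p₃ p₄ : Bool) : Prop :=
  ∃ a b e : Vx n, a ≠ b ∧ a ≠ e ∧ b ≠ e ∧ a ≠ u ∧ b ≠ u ∧ e ≠ u ∧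
    edgeKind n c u a p₁ ∧ edgeKind n c a b p₂ ∧ edgeKind n c b e p₃ ∧ edgeKind n c e u p₄

/-- `ζ(3) = ∑_{i ≥ 1} i⁻³`. -/
noncomputable def zeta3 : ℝ := ∑' i : ℕ, ((i + 1 : ℝ) ^ 3)⁻¹

/-- The cyclic distance on `Fin n`. -/
def cdist {n : ℕ} (x y : Fin n) : ℕ :=
  min ((x : ℤ) - (y : ℤ)).natAbs (n - ((x : ℤ) - (y : ℤ)).natAbs)

theorem tdist_eq_cdist {n : ℕ} (u v : Vx n) : tdist n u v = cdist u.1 v.1 + cdist u.2 v.2 := rfl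

theorem cdist_comm {n : ℕ} (x y : Fin n) : cdist x y = cdist y x := by
  unfold cdist
  omega

theorem tdist_comm {n : ℕ} (u v : Vx n) : tdist n u v = tdist n v u := by
  rw [tdist_eq_cdist, tdist_eq_cdist, cdist_comm u.1, cdist_comm u.2]

theorem cdist_add_right {n : ℕ} (x y t : Fin n) : cdist (x + t) (y + t) = cdist x y := by
  have hx := x.isLt
  have hy := y.isLt
  have ht := t.isLt
  unfold cdist
  rw [Fin.val_add_eq_ite, Fin.val_add_eq_ite]
  split_ifs <;> omega

theorem tdist_add_right {n : ℕ} (u v t : Vx n) : tdist n (u + t) (v + t) = tdist n u v := by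
  simp only [tdist_eq_cdist, Prod.fst_add, Prod.snd_add, cdist_add_right]

theorem cdist_zero_le {n : ℕ} [NeZero n] (x : Fin n) : cdist 0 x ≤ x := by
  unfold cdist
  simp

theorem eq_of_cdist_eq_zero {n : ℕ} {x y : Fin n} (h : cdist x y = 0) : x = y := by
  have hx := x.isLt
  have hy := y.isLt
  unfold cdist at h
  ext
  omega

/-- The sum of inverse squared distances does not depend on the base vertex. -/
theorem Zfac_eq_zero {n : ℕ} [NeZero n] (u : Vx n) : Zfac n u = Zfac n 0 := by
  unfold Zfac
  congr 1
  rw [Finset.sum_filter, Finset.sum_filter]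
  refine (Fintype.sum_equiv (Equiv.addRight u) _ _ fun w => ?_).symm
  have h : tdist n u (w + u) = tdist n 0 w := by
    simpa using tdist_add_right 0 w u
  simp [h]

theorem Zfac_nonneg {n : ℕ} (u : Vx n) : 0 ≤ Zfac n u := by
  unfold Zfac
  positivity

theorem log_le_sum_inv_sq {n : ℕ} [NeZero n] :
    Real.log n / 4 ≤ ∑ w ∈ univ.filter (fun w : Vx n => w ≠ 0), ((tdist n 0 w : ℝ) ^ 2)⁻¹ := by
  obtain ⟨m, rfl⟩ := Nat.exists_eq_succ_of_ne_zero (NeZero.ne n)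
  have hterm : ∀ i j : Fin (m + 1), (if i ≠ 0 ∧ j ≤ i then ((2 * (i : ℝ)) ^ 2)⁻¹ else 0) ≤
      if (i, j) ≠ 0 then ((tdist (m + 1) 0 (i, j) : ℝ) ^ 2)⁻¹ else 0 := by
    intro i j
    by_cases h : i ≠ 0 ∧ j ≤ i
    · have h0 : (i, j) ≠ 0 := fun h' => h.1 (congrArg Prod.fst h')
      rw [if_pos h, if_pos h0]
      have hpos : 0 < tdist (m + 1) 0 (i, j) := by
        rw [tdist_eq_cdist]
        refine Nat.pos_of_ne_zero fun h' => h.1 ?_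
        exact (eq_of_cdist_eq_zero (Nat.eq_zero_of_add_eq_zero_right h')).symm
      have hle : tdist (m + 1) 0 (i, j) ≤ 2 * i := by
        rw [tdist_eq_cdist]
        have h1 := cdist_zero_le i
        have h2 := cdist_zero_le j
        have h3 : (j : ℕ) ≤ i := h.2
        simp only [Prod.fst_zero, Prod.snd_zero]
        omega
      have hle' : (tdist (m + 1) 0 (i, j) : ℝ) ≤ 2 * i := by exact_mod_cast hle
      have hpos' : (0 : ℝ) < tdist (m + 1) 0 (i, j) := by exact_mod_cast hpos
      gcongr
    · rw [if_neg h]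
      positivity
  rw [Finset.sum_filter, Fintype.sum_prod_type]
  refine le_trans ?_ (Finset.sum_le_sum fun i _ => Finset.sum_le_sum fun j _ => hterm i j)
  rw [Fin.sum_univ_succ]
  have hin : ∀ i : Fin m, ((i : ℝ) + 1)⁻¹ / 4 ≤
      ∑ j : Fin (m + 1), if i.succ ≠ 0 ∧ j ≤ i.succ then ((2 * ((i.succ : Fin (m + 1)) : ℝ)) ^ 2)⁻¹
        else 0 := by
    intro i
    have hc : ((univ.filter fun j : Fin (m + 1) => j ≤ i.succ).card : ℝ) = (i : ℝ) + 2 := by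
      have : (univ.filter fun j : Fin (m + 1) => j ≤ i.succ) = Finset.Iic i.succ := by
        ext j
        simp
      rw [this, Fin.card_Iic]
      push_cast [Fin.val_succ]
      ring
    simp only [ne_eq, Fin.succ_ne_zero, not_false_eq_true, true_and]
    rw [← Finset.sum_filter, Finset.sum_const, nsmul_eq_mul, hc]
    push_cast [Fin.val_succ]
    have : (0 : ℝ) < (i : ℝ) + 1 := by positivity
    rw [mul_pow, mul_inv, inv_eq_one_div, div_div, div_le_iff₀ (by positivity)]
    field_simp
    nlinarith
  have hharm : Real.log ((m + 1 : ℕ) : ℝ) ≤ ∑ i : Fin m, ((i : ℝ) + 1)⁻¹ := by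
    have h := log_add_one_le_harmonic m
    rw [harmonic] at h
    push_cast at h ⊢
    rw [Fin.sum_univ_eq_sum_range (fun i : ℕ => ((i : ℝ) + 1)⁻¹) m]
    exact h
  calc Real.log ((m + 1 : ℕ) : ℝ) / 4 ≤ (∑ i : Fin m, ((i : ℝ) + 1)⁻¹) / 4 := by gcongr
    _ = ∑ i : Fin m, ((i : ℝ) + 1)⁻¹ / 4 := Finset.sum_div _ _ _
    _ ≤ _ := Finset.sum_le_sum fun i _ => hin i
    _ ≤ _ := le_add_of_nonneg_left (by positivity)

theorem Zfac_le {n : ℕ} (hn : 3 ≤ n) (u : Vx n) : Zfac n u ≤ 4 / Real.log n := by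
  have : NeZero n := ⟨by omega⟩
  have hlog : 0 < Real.log n := Real.log_pos (by exact_mod_cast (by omega : 1 < n))
  rw [Zfac_eq_zero, ← inv_div, Zfac]
  exact inv_anti₀ (by positivity) log_le_sum_inv_sq

/-- The probability that `u` chooses `v`. -/
noncomputable def choiceProb (n : ℕ) (u v : Vx n) : ℝ :=
  if v = u then 0 else Zfac n u * ((tdist n u v : ℝ) ^ 2)⁻¹

theorem mass_eq_prod_choiceProb {n : ℕ} (c : Vx n → Vx n) :
    mass n c = ∏ u, choiceProb n u (c u) := rfl

theorem choiceProb_nonneg {n : ℕ} (u v : Vx n) : 0 ≤ choiceProb n u v := by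
  unfold choiceProb
  have := Zfac_nonneg u
  positivity

theorem mass_nonneg {n : ℕ} (c : Vx n → Vx n) : 0 ≤ mass n c :=
  Finset.prod_nonneg fun u _ => choiceProb_nonneg u (c u)

theorem choiceProb_comm {n : ℕ} [NeZero n] (u v : Vx n) :
    choiceProb n u v = choiceProb n v u := by
  unfold choiceProb
  rw [Zfac_eq_zero u, Zfac_eq_zero v, tdist_comm u v]
  simp only [eq_comm]

theorem choiceProb_le_Zfac {n : ℕ} (u v : Vx n) : choiceProb n u v ≤ Zfac n u := by
  unfold choiceProb
  have hZ := Zfac_nonneg u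
  split_ifs
  · exact hZ
  · refine mul_le_of_le_one_right hZ ?_
    rcases Nat.eq_zero_or_pos (tdist n u v) with h | h
    · simp [h]
    · have : (1 : ℝ) ≤ tdist n u v := by exact_mod_cast h
      exact inv_le_one_of_one_le₀ (one_le_pow₀ this)

theorem sum_choiceProb_le_one {n : ℕ} (u : Vx n) : ∑ v, choiceProb n u v ≤ 1 := by
  have : ∑ v, choiceProb n u v = Zfac n u *
      ∑ v ∈ univ.filter (fun v => v ≠ u), ((tdist n u v : ℝ) ^ 2)⁻¹ := by
    rw [Finset.mul_sum, Finset.sum_filter]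
    refine Finset.sum_congr rfl fun v _ => ?_
    simp [choiceProb]
  rw [this, Zfac]
  exact inv_mul_le_one

/-- For a subprobability weight `f`, the expectation of a product of indicators of the events
`v = a.2` over a set of pairs with common first entry is at most the product of the weights. -/
theorem sum_mul_prod_indicator_le {V : Type*} [Fintype V] [DecidableEq V] (f : V → ℝ)
    (hf : ∀ v, 0 ≤ f v) (hs : ∑ v, f v ≤ 1) (s : V) (B : Finset (V × V)) (hB : ∀ a ∈ B, a.1 = s) :
    ∑ v, f v * ∏ a ∈ B, (if v = a.2 then (1 : ℝ) else 0) ≤ ∏ a ∈ B, f a.2 := by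
  rcases B.eq_empty_or_nonempty with rfl | ⟨a, ha⟩
  · simpa using hs
  by_cases hsing : B = {a}
  · subst hsing
    simp
  · obtain ⟨b, hb, hba⟩ : ∃ b ∈ B, b ≠ a := by
      by_contra! h
      exact hsing (Finset.eq_singleton_iff_unique_mem.2 ⟨ha, h⟩)
    refine le_trans (le_of_eq ?_) (Finset.prod_nonneg fun a _ => hf a.2)
    refine Finset.sum_eq_zero fun v _ => mul_eq_zero_of_right _ ?_
    by_cases hv : v = a.2
    · refine Finset.prod_eq_zero hb (if_neg fun h => hba ?_)
      exact Prod.ext ((hB b hb).trans (hB a ha).symm) (h.symm.trans hv)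
    · exact Finset.prod_eq_zero ha (if_neg hv)

theorem sum_mass_mul_prod_indicator_le {n : ℕ} (A : Finset (Vx n × Vx n)) :
    ∑ c : Vx n → Vx n, mass n c * ∏ a ∈ A, (if c a.1 = a.2 then (1 : ℝ) else 0) ≤
      ∏ a ∈ A, choiceProb n a.1 a.2 := by
  have h1 : ∀ c : Vx n → Vx n,
      mass n c * ∏ a ∈ A, (if c a.1 = a.2 then (1 : ℝ) else 0) =
      ∏ s, (choiceProb n s (c s) *
        ∏ a ∈ A with a.1 = s, (if c s = a.2 then (1 : ℝ) else 0)) := by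
    intro c
    rw [Finset.prod_mul_distrib, mass_eq_prod_choiceProb]
    congr 1
    rw [← Finset.prod_fiberwise A (fun a => a.1)]
    refine Finset.prod_congr rfl fun s _ => Finset.prod_congr rfl fun a ha => ?_
    rw [(Finset.mem_filter.1 ha).2]
  simp_rw [h1]
  rw [← Fintype.prod_sum (fun s v => choiceProb n s v *
        ∏ a ∈ A with a.1 = s, (if v = a.2 then (1 : ℝ) else 0)),
    ← Finset.prod_fiberwise A (fun a => a.1)]
  refine Finset.prod_le_prod (fun s _ => ?_) fun s _ => ?_
  · refine Finset.sum_nonneg fun v _ => mul_nonneg (choiceProb_nonneg s v) ?_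
    positivity
  · refine (sum_mul_prod_indicator_le (choiceProb n s) (choiceProb_nonneg s)
      (sum_choiceProb_le_one s) s _ fun a ha => (Finset.mem_filter.1 ha).2).trans (le_of_eq ?_)
    refine Finset.prod_congr rfl fun a ha => ?_
    rw [(Finset.mem_filter.1 ha).2]

theorem sum_mass_mul_prod_edges_le {n : ℕ} {ι : Type*} (x y : ι → Vx n) (l : ι → ℝ)
    (hl : ∀ i, 0 ≤ l i)
    (h₁ : ∀ i j, i ≠ j → (x i, y i) ≠ (x j, y j))
    (h₂ : ∀ i j, i ≠ j → (x i, y i) ≠ (y j, x j)) (s : Finset ι) :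
    ∀ A : Finset (Vx n × Vx n), (∀ i ∈ s, (x i, y i) ∉ A ∧ (y i, x i) ∉ A) →
    ∑ c : Vx n → Vx n, mass n c * ((∏ a ∈ A, (if c a.1 = a.2 then (1 : ℝ) else 0)) *
      ∏ i ∈ s, (l i + (if c (x i) = y i then 1 else 0) + (if c (y i) = x i then 1 else 0))) ≤
      (∏ a ∈ A, choiceProb n a.1 a.2) *
        ∏ i ∈ s, (l i + choiceProb n (x i) (y i) + choiceProb n (y i) (x i)) := by
  induction s using Finset.induction_on with
  | empty =>
    intro A _
    simpa using sum_mass_mul_prod_indicator_le A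
  | insert i s hi ih =>
    intro A hA
    have hAi := hA i (Finset.mem_insert_self i s)
    have hAs : ∀ j ∈ s, (x j, y j) ∉ A ∧ (y j, x j) ∉ A :=
      fun j hj => hA j (Finset.mem_insert_of_mem hj)
    have e0 := mul_le_mul_of_nonneg_left (ih A hAs) (hl i)
    have e1 := ih (insert (x i, y i) A) fun j hj => by
      have hji : j ≠ i := fun h => hi (h ▸ hj)
      have a1 := h₁ j i hji
      have a2 := h₂ i j hji.symm
      simp only [Finset.mem_insert, not_or]
      exact ⟨⟨a1, (hAs j hj).1⟩, a2.symm, (hAs j hj).2⟩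
    have e2 := ih (insert (y i, x i) A) fun j hj => by
      have hji : j ≠ i := fun h => hi (h ▸ hj)
      have a1 := h₁ j i hji
      have a2 := h₂ j i hji
      simp only [Finset.mem_insert, not_or]
      refine ⟨⟨a2, (hAs j hj).1⟩, fun h => a1 ?_, (hAs j hj).2⟩
      simp only [Prod.mk.injEq] at h ⊢
      exact h.symm
    simp only [Finset.prod_insert hAi.1] at e1
    simp only [Finset.prod_insert hAi.2] at e2
    rw [Finset.mul_sum] at e0
    simp only [Finset.prod_insert hi]
    refine le_trans (le_of_eq ?_) ((add_le_add (add_le_add e0 e1) e2).trans (le_of_eq (by ring)))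
    rw [← Finset.sum_add_distrib, ← Finset.sum_add_distrib]
    refine Finset.sum_congr rfl fun c _ => ?_
    ring

/-- Translation of a coordinate of the torus by an integer. -/
def cshift {n : ℕ} (x : Fin n) (d : ℤ) : Fin n :=
  ⟨((x + d) % (n : ℤ)).toNat, by
    have hn : (0 : ℤ) < n := by exact_mod_cast x.pos
    have h1 := Int.emod_nonneg (x + d) hn.ne'
    have h2 := Int.emod_lt_of_pos (x + d) hn
    omega⟩

theorem cshift_val {n : ℕ} (x : Fin n) (d : ℤ) : ((cshift x d : ℕ) : ℤ) = (x + d) % n := by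
  have hn : (0 : ℤ) < n := by exact_mod_cast x.pos
  exact Int.toNat_of_nonneg (Int.emod_nonneg _ hn.ne')

theorem cshift_cshift {n : ℕ} (x : Fin n) (d d' : ℤ) :
    cshift (cshift x d) d' = cshift x (d + d') := by
  have h : ((cshift (cshift x d) d' : ℕ) : ℤ) = (cshift x (d + d') : ℕ) := by
    rw [cshift_val, cshift_val, cshift_val, Int.emod_add_emod, add_assoc]
  exact Fin.ext (by exact_mod_cast h)

theorem eq_cshift {n : ℕ} {x y : Fin n} {d q : ℤ} (h : (x + d : ℤ) = y + n * q) :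
    y = cshift x d := by
  have h' : ((cshift x d : ℕ) : ℤ) = (y : ℕ) := by
    rw [cshift_val, h, Int.add_mul_emod_self_left]
    exact Int.emod_eq_of_lt (by positivity) (by exact_mod_cast y.isLt)
  exact Fin.ext (by exact_mod_cast h'.symm)

theorem cshift_zero {n : ℕ} (x : Fin n) : cshift x 0 = x :=
  (eq_cshift (q := 0) (by ring)).symm

theorem eq_zero_of_cshift_eq {n : ℕ} {x : Fin n} {d : ℤ} (h : cshift x d = x) (hd : |d| < n) :
    d = 0 := by
  have h' := cshift_val x d
  rw [h] at h'
  have : (n : ℤ) ∣ d := by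
    have h2 := Int.dvd_sub_self_of_emod_eq h'.symm
    simpa using h2
  exact Int.eq_zero_of_abs_lt_dvd this hd

theorem cshift_of_cdist_eq_one {n : ℕ} {x y : Fin n} (h : cdist x y = 1) :
    y = cshift x 1 ∨ y = cshift x (-1) := by
  have hx := x.isLt
  have hy := y.isLt
  have key : (x + 1 : ℤ) = y + n * 0 ∨ (x + 1 : ℤ) = y + n * 1 ∨
      (x + -1 : ℤ) = y + n * 0 ∨ (x + -1 : ℤ) = y + n * (-1) := by
    unfold cdist at h
    omega
  rcases key with k | k | k | k
  · exact Or.inl (eq_cshift k)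
  · exact Or.inl (eq_cshift k)
  · exact Or.inr (eq_cshift k)
  · exact Or.inr (eq_cshift k)

/-- Translation of a vertex of the torus by an integer vector. -/
def vshift {n : ℕ} (u : Vx n) (d : ℤ × ℤ) : Vx n := (cshift u.1 d.1, cshift u.2 d.2)

theorem vshift_vshift {n : ℕ} (u : Vx n) (d d' : ℤ × ℤ) :
    vshift (vshift u d) d' = vshift u (d + d') := by
  simp [vshift, cshift_cshift]

theorem vshift_zero {n : ℕ} (u : Vx n) : vshift u 0 = u := by
  simp [vshift, cshift_zero]

/-- The four unit steps on the square lattice. -/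
def unitSteps : Finset (ℤ × ℤ) := {(1, 0), (-1, 0), (0, 1), (0, -1)}

theorem exists_step_of_tdist_eq_one {n : ℕ} {u v : Vx n} (h : tdist n u v = 1) :
    ∃ d ∈ unitSteps, v = vshift u d := by
  obtain ⟨v₁, v₂⟩ := v
  rw [tdist_eq_cdist] at h
  rcases Nat.add_eq_one_iff.1 h with ⟨h1, h2⟩ | ⟨h1, h2⟩
  · have e := eq_of_cdist_eq_zero h1
    rcases cshift_of_cdist_eq_one h2 with k | k
    · exact ⟨(0, 1), by decide, Prod.ext (by simp [vshift, cshift_zero, e]) k⟩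
    · exact ⟨(0, -1), by decide, Prod.ext (by simp [vshift, cshift_zero, e]) k⟩
  · have e := eq_of_cdist_eq_zero h2
    rcases cshift_of_cdist_eq_one h1 with k | k
    · exact ⟨(1, 0), by decide, Prod.ext k (by simp [vshift, cshift_zero, e])⟩
    · exact ⟨(-1, 0), by decide, Prod.ext k (by simp [vshift, cshift_zero, e])⟩

/-- The indicator of a local edge. -/
noncomputable def localEdge (n : ℕ) (u v : Vx n) : ℝ := if tdist n u v = 1 then 1 else 0

theorem localEdge_nonneg {n : ℕ} (u v : Vx n) : 0 ≤ localEdge n u v := by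
  unfold localEdge
  positivity

theorem localEdge_comm {n : ℕ} (u v : Vx n) : localEdge n u v = localEdge n v u := by
  unfold localEdge
  rw [tdist_comm]

theorem sum_localEdge_le {n : ℕ} (u : Vx n) : ∑ v, localEdge n u v ≤ 4 := by
  unfold localEdge
  rw [Finset.sum_boole]
  have hsub : (univ.filter fun v => tdist n u v = 1) ⊆ unitSteps.image (vshift u) := by
    intro v hv
    obtain ⟨d, hd, rfl⟩ := exists_step_of_tdist_eq_one (Finset.mem_filter.1 hv).2
    exact Finset.mem_image_of_mem _ hd
  have hcard : (univ.filter fun v => tdist n u v = 1).card ≤ 4 :=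
    (Finset.card_le_card hsub).trans (Finset.card_image_le.trans (by decide))
  exact_mod_cast hcard

/-- Triples completing `u` to a four-cycle with pairwise distinct vertices. -/
def DistinctFrom {V : Type*} (u : V) (t : V × V × V) : Prop :=
  t.1 ≠ t.2.1 ∧ t.1 ≠ t.2.2 ∧ t.2.1 ≠ t.2.2 ∧ t.1 ≠ u ∧ t.2.1 ≠ u ∧ t.2.2 ≠ u

/-- Triples of unit steps which begin a nondegenerate four-cycle of the square lattice. -/
def squareSteps : Finset ((ℤ × ℤ) × (ℤ × ℤ) × (ℤ × ℤ)) :=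
  (unitSteps ×ˢ unitSteps ×ˢ unitSteps).filter fun d =>
    d.1 + d.2.1 ≠ 0 ∧ d.2.1 + d.2.2 ≠ 0 ∧ -(d.1 + d.2.1 + d.2.2) ∈ unitSteps

theorem card_squareSteps : squareSteps.card = 8 := by
  decide

theorem abs_le_one_of_mem_unitSteps {d : ℤ × ℤ} (hd : d ∈ unitSteps) : |d.1| ≤ 1 ∧ |d.2| ≤ 1 := by
  revert d
  decide

theorem card_local_cycles_le {n : ℕ} (hn : 5 ≤ n) (u : Vx n) :
    (univ.filter fun t : Vx n × Vx n × Vx n => DistinctFrom u t ∧ tdist n u t.1 = 1 ∧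
      tdist n t.1 t.2.1 = 1 ∧ tdist n t.2.1 t.2.2 = 1 ∧ tdist n t.2.2 u = 1).card ≤ 8 := by
  rw [← card_squareSteps]
  refine (Finset.card_le_card ?_).trans (Finset.card_image_le (f := fun d =>
    (vshift u d.1, vshift u (d.1 + d.2.1), vshift u (d.1 + d.2.1 + d.2.2))))
  rintro ⟨a, b, e⟩ ht
  obtain ⟨-, ⟨-, hae, -, -, hbu, -⟩, h1, h2, h3, h4⟩ := Finset.mem_filter.1 ht
  dsimp only at hae hbu h1 h2 h3 h4
  obtain ⟨d₁, hd₁, rfl⟩ := exists_step_of_tdist_eq_one h1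
  obtain ⟨d₂, hd₂, rfl⟩ := exists_step_of_tdist_eq_one h2
  obtain ⟨d₃, hd₃, rfl⟩ := exists_step_of_tdist_eq_one h3
  obtain ⟨d₄, hd₄, h⟩ := exists_step_of_tdist_eq_one h4
  simp only [vshift_vshift] at hae hbu h ⊢
  have b1 := abs_le_one_of_mem_unitSteps hd₁
  have b2 := abs_le_one_of_mem_unitSteps hd₂
  have b3 := abs_le_one_of_mem_unitSteps hd₃
  have b4 := abs_le_one_of_mem_unitSteps hd₄
  simp only [abs_le] at b1 b2 b3 b4
  have z1 : (d₁ + d₂ + d₃ + d₄).1 = 0 := by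
    refine eq_zero_of_cshift_eq (congrArg Prod.fst h).symm ?_
    simp only [Prod.fst_add, abs_lt]
    omega
  have z2 : (d₁ + d₂ + d₃ + d₄).2 = 0 := by
    refine eq_zero_of_cshift_eq (congrArg Prod.snd h).symm ?_
    simp only [Prod.snd_add, abs_lt]
    omega
  have z : d₁ + d₂ + d₃ + d₄ = 0 := Prod.ext z1 z2
  refine Finset.mem_image.2 ⟨(d₁, d₂, d₃), ?_, rfl⟩
  refine Finset.mem_filter.2 ⟨by simp [hd₁, hd₂, hd₃], fun h' => hbu ?_, fun h' => hae ?_, ?_⟩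
  · rw [h', vshift_zero]
  · rw [add_assoc, h', add_zero]
  · rwa [neg_eq_of_add_eq_zero_right z]

theorem mul_four_le {l₁ l₂ l₃ l₄ k₁ k₂ k₃ k₄ ε : ℝ}
    (hl₁ : 0 ≤ l₁) (hl₂ : 0 ≤ l₂) (hl₃ : 0 ≤ l₃) (hl₄ : 0 ≤ l₄)
    (hk₁ : 0 ≤ k₁) (hk₂ : 0 ≤ k₂) (hk₃ : 0 ≤ k₃) (hk₄ : 0 ≤ k₄)
    (h₁ : k₁ ≤ ε) (h₂ : k₂ ≤ ε) (h₃ : k₃ ≤ ε) (h₄ : k₄ ≤ ε) :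
    (l₁ + k₁) * (l₂ + k₂) * (l₃ + k₃) * (l₄ + k₄) ≤ l₁ * l₂ * l₃ * l₄ +
      ε * ((l₁ + k₁) * (l₂ + k₂) * (l₃ + k₃) + (l₁ + k₁) * (l₂ + k₂) * (l₄ + k₄) +
        (l₄ + k₄) * (l₃ + k₃) * (l₁ + k₁) + (l₄ + k₄) * (l₃ + k₃) * (l₂ + k₂)) := by
  have hε : 0 ≤ ε := hk₁.trans h₁
  have e₁ : k₁ * (l₂ * l₃ * l₄) ≤ ε * ((l₂ + k₂) * (l₃ + k₃) * (l₄ + k₄)) := by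
    gcongr <;> linarith
  have e₂ : k₂ * ((l₁ + k₁) * l₃ * l₄) ≤ ε * ((l₁ + k₁) * (l₃ + k₃) * (l₄ + k₄)) := by
    gcongr <;> linarith
  have e₃ : k₃ * ((l₁ + k₁) * (l₂ + k₂) * l₄) ≤ ε * ((l₁ + k₁) * (l₂ + k₂) * (l₄ + k₄)) := by
    gcongr
    linarith
  have e₄ : k₄ * ((l₁ + k₁) * (l₂ + k₂) * (l₃ + k₃)) ≤
      ε * ((l₁ + k₁) * (l₂ + k₂) * (l₃ + k₃)) := by
    gcongr
  linarith

section PathSums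

variable {V : Type*} [Fintype V] {q : V → V → ℝ} {M : ℝ}

theorem sum_path_le (hq : ∀ x y, 0 ≤ q x y) (hM : ∀ x, ∑ y, q x y ≤ M) (u : V) :
    ∑ t : V × V × V, q u t.1 * q t.1 t.2.1 * q t.2.1 t.2.2 ≤ M ^ 3 := by
  have hM0 : 0 ≤ M := (Finset.sum_nonneg fun y _ => hq u y).trans (hM u)
  simp only [Fintype.sum_prod_type, ← Finset.mul_sum]
  calc ∑ a, ∑ b, q u a * q a b * ∑ e, q b e
      ≤ ∑ a, ∑ b, q u a * q a b * M := by
        gcongr with a _ b _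
        · exact mul_nonneg (hq u a) (hq a b)
        · exact hM b
    _ = (∑ a, q u a * ∑ b, q a b) * M := by
        simp only [Finset.sum_mul, Finset.mul_sum]
    _ ≤ (∑ a, q u a * M) * M := by
        gcongr with a _
        · exact hq u a
        · exact hM a
    _ = (∑ a, q u a) * M * M := by rw [← Finset.sum_mul]
    _ ≤ M * M * M := by
        gcongr
        exact hM u
    _ = M ^ 3 := by ring

theorem sum_path_mul_edge_le (hq : ∀ x y, 0 ≤ q x y) (hM : ∀ x, ∑ y, q x y ≤ M) (u : V) :
    ∑ t : V × V × V, q u t.1 * q t.1 t.2.1 * q u t.2.2 ≤ M ^ 3 := by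
  have hM0 : 0 ≤ M := (Finset.sum_nonneg fun y _ => hq u y).trans (hM u)
  simp only [Fintype.sum_prod_type, ← Finset.mul_sum]
  calc ∑ a, ∑ b, q u a * q a b * ∑ e, q u e
      ≤ ∑ a, ∑ b, q u a * q a b * M := by
        gcongr with a _ b _
        · exact mul_nonneg (hq u a) (hq a b)
        · exact hM u
    _ = (∑ a, q u a * ∑ b, q a b) * M := by
        simp only [Finset.sum_mul, Finset.mul_sum]
    _ ≤ (∑ a, q u a * M) * M := by
        gcongr with a _
        · exact hq u a
        · exact hM a
    _ = (∑ a, q u a) * M * M := by rw [← Finset.sum_mul]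
    _ ≤ M * M * M := by
        gcongr
        exact hM u
    _ = M ^ 3 := by ring

/-- Reversal of the triple completing a rooted four-cycle. -/
def reverseTriple (V : Type*) : V × V × V ≃ V × V × V where
  toFun t := (t.2.2, t.2.1, t.1)
  invFun t := (t.2.2, t.2.1, t.1)
  left_inv _ := rfl
  right_inv _ := rfl

/-- If the edge weights split as `l + k` with `k ≤ ε`, then the closed walks of length four with
at least one edge of weight `k` contribute at most `4 * ε * M ^ 3`. -/
theorem sum_cycle_le {l k : V → V → ℝ} {ε : ℝ} (P : V × V × V → Prop)
    (hl : ∀ x y, 0 ≤ l x y) (hk : ∀ x y, 0 ≤ k x y)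
    (hls : ∀ x y, l x y = l y x) (hks : ∀ x y, k x y = k y x) (hε : ∀ x y, k x y ≤ ε)
    (hM : ∀ x, ∑ y, (l x y + k x y) ≤ M) (u : V) :
    ∑ t ∈ univ.filter P, (l u t.1 + k u t.1) * (l t.1 t.2.1 + k t.1 t.2.1) *
        (l t.2.1 t.2.2 + k t.2.1 t.2.2) * (l t.2.2 u + k t.2.2 u) ≤
      (∑ t ∈ univ.filter P, l u t.1 * l t.1 t.2.1 * l t.2.1 t.2.2 * l t.2.2 u) +
        4 * ε * M ^ 3 := by
  set q : V → V → ℝ := fun x y => l x y + k x y with hqdef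
  have hq : ∀ x y, 0 ≤ q x y := fun x y => add_nonneg (hl x y) (hk x y)
  have hqs : ∀ x y, q x y = q y x := fun x y => by simp only [hqdef, hls x y, hks x y]
  have hlq : ∀ x y, l x y ≤ q x y := fun x y => le_add_of_nonneg_right (hk x y)
  have hε0 : 0 ≤ ε := (hk u u).trans (hε u u)
  have hpt : ∀ t : V × V × V, q u t.1 * q t.1 t.2.1 * q t.2.1 t.2.2 * q t.2.2 u ≤
      l u t.1 * l t.1 t.2.1 * l t.2.1 t.2.2 * l t.2.2 u +
      ε * (q u t.1 * q t.1 t.2.1 * q t.2.1 t.2.2 + q u t.1 * q t.1 t.2.1 * q u t.2.2 +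
        q u t.2.2 * q t.2.2 t.2.1 * q u t.1 + q u t.2.2 * q t.2.2 t.2.1 * q t.2.1 t.1) := by
    rintro ⟨a, b, e⟩
    dsimp only
    rw [hqs e u, hqs e b, hqs b a, hls e u]
    refine (mul_four_le (hl u a) (hl a b) (hl b e) (hl u e) (hk u a) (hk a b) (hk b e) (hk u e)
      (hε u a) (hε a b) (hε b e) (hε u e)).trans (le_of_eq ?_)
    simp only [hqdef, hls b e, hks b e]
  have hnn : ∀ t : V × V × V,
      0 ≤ ε * (q u t.1 * q t.1 t.2.1 * q t.2.1 t.2.2 + q u t.1 * q t.1 t.2.1 * q u t.2.2 +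
        q u t.2.2 * q t.2.2 t.2.1 * q u t.1 + q u t.2.2 * q t.2.2 t.2.1 * q t.2.1 t.1) := by
    intro t
    have h (a b c d e f : V) : 0 ≤ q a b * q c d * q e f :=
      mul_nonneg (mul_nonneg (hq _ _) (hq _ _)) (hq _ _)
    exact mul_nonneg hε0 (add_nonneg (add_nonneg (add_nonneg (h ..) (h ..)) (h ..)) (h ..))
  refine (Finset.sum_le_sum fun t _ => hpt t).trans ?_
  rw [Finset.sum_add_distrib]
  refine add_le_add_right ?_ _
  refine (Finset.sum_le_univ_sum_of_nonneg hnn).trans ?_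
  rw [← Finset.mul_sum, Finset.sum_add_distrib, Finset.sum_add_distrib, Finset.sum_add_distrib]
  have s1 := sum_path_le hq hM u
  have s2 := sum_path_mul_edge_le hq hM u
  have s3 : ∑ t : V × V × V, q u t.2.2 * q t.2.2 t.2.1 * q u t.1 ≤ M ^ 3 := by
    rw [← (reverseTriple V).sum_comp]
    exact s2
  have s4 : ∑ t : V × V × V, q u t.2.2 * q t.2.2 t.2.1 * q t.2.1 t.1 ≤ M ^ 3 := by
    rw [← (reverseTriple V).sum_comp]
    exact s1
  nlinarith

end PathSums

theorem sum_mass_mul_cycle_le {n : ℕ} [NeZero n] (u : Vx n) (t : Vx n × Vx n × Vx n)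
    (ht : DistinctFrom u t) :
    ∑ c : Vx n → Vx n, mass n c * (if isEdge n c u t.1 ∧ isEdge n c t.1 t.2.1 ∧
        isEdge n c t.2.1 t.2.2 ∧ isEdge n c t.2.2 u then (1 : ℝ) else 0) ≤
      (localEdge n u t.1 + 2 * choiceProb n u t.1) *
        (localEdge n t.1 t.2.1 + 2 * choiceProb n t.1 t.2.1) *
        (localEdge n t.2.1 t.2.2 + 2 * choiceProb n t.2.1 t.2.2) *
        (localEdge n t.2.2 u + 2 * choiceProb n t.2.2 u) := by
  obtain ⟨a, b, e⟩ := t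
  obtain ⟨hab, hae, hbe, hau, hbu, heu⟩ := ht
  dsimp only at *
  have key := sum_mass_mul_prod_edges_le ![u, a, b, e] ![a, b, e, u]
    ![localEdge n u a, localEdge n a b, localEdge n b e, localEdge n e u]
    (fun i => by fin_cases i <;> exact localEdge_nonneg _ _)
    (fun i j hij => by
      fin_cases i <;> fin_cases j <;> simp [*, hau.symm, hbu.symm, heu.symm, hab.symm, hae.symm,
        hbe.symm] at hij ⊢)
    (fun i j hij => by
      fin_cases i <;> fin_cases j <;> simp [*, hau.symm, hbu.symm, heu.symm, hab.symm, hae.symm,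
        hbe.symm] at hij ⊢)
    univ ∅ (by simp)
  have hp : ∀ x y, localEdge n x y + choiceProb n x y + choiceProb n y x =
      localEdge n x y + 2 * choiceProb n x y := fun x y => by
    rw [choiceProb_comm y x]
    ring
  have he : ∀ (c : Vx n → Vx n) x y, (if isEdge n c x y then (1 : ℝ) else 0) ≤
      localEdge n x y + (if c x = y then 1 else 0) + (if c y = x then 1 else 0) := by
    intro c x y
    unfold isEdge localEdge
    by_cases h1 : tdist n x y = 1 <;> by_cases h2 : c x = y <;> by_cases h3 : c y = x <;>
      simp only [h1, h2, h3] <;> split_ifs <;> norm_num at *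
  simp only [Finset.prod_empty, one_mul, Fin.prod_univ_four, Matrix.cons_val, hp] at key
  refine le_trans (Finset.sum_le_sum fun c _ => mul_le_mul_of_nonneg_left ?_ (mass_nonneg c)) key
  have hprod : (if isEdge n c u a ∧ isEdge n c a b ∧ isEdge n c b e ∧ isEdge n c e u
      then (1 : ℝ) else 0) = (if isEdge n c u a then 1 else 0) * (if isEdge n c a b then 1 else 0) *
        (if isEdge n c b e then 1 else 0) * (if isEdge n c e u then 1 else 0) := by
    simp only [← ite_and, mul_ite, mul_one, mul_zero]
    congr 1
    simp only [eq_iff_iff]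
    tauto
  rw [hprod]
  have he0 : ∀ x y, 0 ≤ localEdge n x y + (if c x = y then 1 else 0) +
      (if c y = x then 1 else 0) := fun x y => by
    have := localEdge_nonneg x y
    positivity
  have hi0 : ∀ x y, (0 : ℝ) ≤ if isEdge n c x y then 1 else 0 := fun x y => by positivity
  exact mul_le_mul (mul_le_mul (mul_le_mul (he c _ _) (he c _ _) (hi0 _ _) (he0 _ _))
    (he c _ _) (hi0 _ _) (mul_nonneg (he0 _ _) (he0 _ _))) (he c _ _) (hi0 _ _)
    (mul_nonneg (mul_nonneg (he0 _ _) (he0 _ _)) (he0 _ _))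

theorem expected_rooted_cycles_le {n : ℕ} (hn : 3 ≤ n) (u : Vx n) :
    ∑ c : Vx n → Vx n, mass n c *
        (((univ.filter (fun t : Vx n × Vx n × Vx n =>
            t.1 ≠ t.2.1 ∧ t.1 ≠ t.2.2 ∧ t.2.1 ≠ t.2.2 ∧
            t.1 ≠ u ∧ t.2.1 ≠ u ∧ t.2.2 ≠ u ∧
            isEdge n c u t.1 ∧ isEdge n c t.1 t.2.1 ∧
            isEdge n c t.2.1 t.2.2 ∧ isEdge n c t.2.2 u)).card : ℝ)) ≤
      (∑ t ∈ univ.filter (DistinctFrom u), localEdge n u t.1 * localEdge n t.1 t.2.1 *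
        localEdge n t.2.1 t.2.2 * localEdge n t.2.2 u) + 6912 / Real.log n := by
  have : NeZero n := ⟨by omega⟩
  have hcycle := sum_cycle_le (l := localEdge n) (k := fun x y => 2 * choiceProb n x y)
    (ε := 2 * (4 / Real.log n)) (M := 6) (DistinctFrom u) localEdge_nonneg
    (fun x y => mul_nonneg zero_le_two (choiceProb_nonneg x y)) localEdge_comm
    (fun x y => by rw [choiceProb_comm])
    (fun x y => mul_le_mul_of_nonneg_left
      ((choiceProb_le_Zfac x y).trans (Zfac_le hn x)) zero_le_two)
    (fun x => by
      rw [Finset.sum_add_distrib, ← Finset.mul_sum]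
      linarith [sum_localEdge_le x, sum_choiceProb_le_one x]) u
  refine le_trans ?_ (hcycle.trans (le_of_eq (by ring)))
  refine le_trans (le_of_eq ?_)
    (Finset.sum_le_sum fun t ht => sum_mass_mul_cycle_le u t (Finset.mem_filter.1 ht).2)
  rw [Finset.sum_comm]
  refine Finset.sum_congr rfl fun c _ => ?_
  rw [← Finset.mul_sum, Finset.sum_boole, Finset.filter_filter]
  simp only [DistinctFrom, and_assoc]

theorem sum_local_cycles_le {n : ℕ} (u : Vx n) :
    ∑ t ∈ univ.filter (DistinctFrom u), localEdge n u t.1 * localEdge n t.1 t.2.1 *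
      localEdge n t.2.1 t.2.2 * localEdge n t.2.2 u ≤ 64 := by
  have hnn : ∀ t : Vx n × Vx n × Vx n,
      0 ≤ localEdge n u t.1 * localEdge n t.1 t.2.1 * localEdge n t.2.1 t.2.2 := fun t =>
    mul_nonneg (mul_nonneg (localEdge_nonneg _ _) (localEdge_nonneg _ _)) (localEdge_nonneg _ _)
  have h1 : ∀ x y : Vx n, localEdge n x y ≤ 1 := fun x y => by
    unfold localEdge
    split_ifs <;> norm_num
  refine (Finset.sum_le_sum fun t _ => mul_le_of_le_one_right (hnn t) (h1 t.2.2 u)).trans ?_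
  refine (Finset.sum_le_univ_sum_of_nonneg hnn).trans ?_
  exact (sum_path_le localEdge_nonneg sum_localEdge_le u).trans (by norm_num)

theorem sum_local_cycles_le_of_five_le {n : ℕ} (hn : 5 ≤ n) (u : Vx n) :
    ∑ t ∈ univ.filter (DistinctFrom u), localEdge n u t.1 * localEdge n t.1 t.2.1 *
      localEdge n t.2.1 t.2.2 * localEdge n t.2.2 u ≤ 8 := by
  have h := card_local_cycles_le hn u
  refine le_trans (le_of_eq ?_) (Nat.cast_le.2 h)
  rw [← Finset.filter_filter, ← Finset.sum_boole]
  refine Finset.sum_congr rfl fun t _ => ?_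
  simp only [localEdge, ← ite_and, mul_ite, mul_one, mul_zero]
  congr 1
  simp only [eq_iff_iff]
  tauto

/-- The expected number of undirected four-cycles rooted at `u` in the UTSW random graph
(each cycle counted once, identifying `(a, b, e)` with its reversal `(e, b, a)`)
is at most `4 + C / ln n` for an absolute constant `C > 0`. -/
theorem expected_num_four_cycles :
    ∃ C > (0 : ℝ), ∀ n : ℕ, 3 ≤ n → ∀ u : Vx n,
      (∑ c : Vx n → Vx n, mass n c *
        (((univ.filter (fun t : Vx n × Vx n × Vx n =>
            t.1 ≠ t.2.1 ∧ t.1 ≠ t.2.2 ∧ t.2.1 ≠ t.2.2 ∧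
            t.1 ≠ u ∧ t.2.1 ≠ u ∧ t.2.2 ≠ u ∧
            isEdge n c u t.1 ∧ isEdge n c t.1 t.2.1 ∧
            isEdge n c t.2.1 t.2.2 ∧ isEdge n c t.2.2 u)).card : ℝ) / 2)) ≤
        4 + C / Real.log (n : ℝ) := by
  refine ⟨4000, by norm_num, fun n hn u => ?_⟩
  have hmain := expected_rooted_cycles_le hn u
  have hlog : 0 < Real.log n := Real.log_pos (by exact_mod_cast (by omega : 1 < n))
  simp only [← mul_div_assoc, ← Finset.sum_div]
  have hdiv : ∀ a : ℝ, a / Real.log n = a * (Real.log n)⁻¹ := fun a => div_eq_mul_inv a _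
  rw [hdiv] at hmain ⊢
  rcases le_or_gt 5 n with h5 | h5
  · have := sum_local_cycles_le_of_five_le h5 u
    have := inv_pos.2 hlog
    linarith
  · have h64 := sum_local_cycles_le u
    have hlog4 : Real.log n ≤ 4 :=
      (Real.log_le_self (by positivity)).trans (by exact_mod_cast (by omega : n ≤ 4))
    have := inv_anti₀ hlog hlog4
    norm_num at this
    linarith
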